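/- Suppose C̃_p + ε < C_p − ε for some ε > 0, and let δ = δ(p,ε) > 0 be sufficiently small. For each N let K = ⌊(C_p − ε)·log N⌋ (so K ≥ (C̃_p + ε)·log N for N large). Set A = ⌊(1−δ)·log N/(2·I(p,p^{θ_p}))⌋ and choose nonnegative integers A_0,…,A_{k−1} with ∑_i A_i = A and |A_i − A·p_i^{θ_p}/φ_p(θ_p)| ≤ 1; set B = K − A and choose nonnegative integers B_0,…,B_{k−1} with ∑_i B_i = B and |B_i − B·p_i²/φ_p(2)| ≤ 1. Call a string s ∈ {0,…,k−1}^K collision-likely if its first A digits contain exactly A_i digits equal to i for each i, its (A+1)-st digit is 0, its (A+2)-nd digit is 1, and its last B digits contain exactly B_i digits equal to i for each i. Define γ = 2 + (2/log N)·∑_{i=0}^{k−1}(A_i+B_i)·log p_i + (A/log N)·H(A_0,…,A_{k−1}) + (B/log N)·H(B_0,…,B_{k−1}). Then, for a p-random sequence S = (s_1,…,s_N) of strings of length K, the probability that at least N^{γ−δ} distinct collision-likely strings each appear two or more times among s_1,…,s_N tends to 1 as N → ∞. -/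

import Mathlib

open Finset

namespace RiffleShuffle

/-- `phi p t = ∑ i, p i ^ t`. -/
noncomputable def phi {k : ℕ} (p : Fin k → ℝ) (t : ℝ) : ℝ := ∑ i, p i ^ t

/-- `psi p t = - log (phi p t)`. -/
noncomputable def psi {k : ℕ} (p : Fin k → ℝ) (t : ℝ) : ℝ := - Real.log (phi p t)

/-- The maximal entry of `p`. -/
noncomputable def pmax {k : ℕ} (p : Fin k → ℝ) : ℝ := ⨆ i, p i

/-- The minimal entry of `p`. -/
noncomputable def pmin {k : ℕ} (p : Fin k → ℝ) : ℝ := ⨅ i, p i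

/-- `C_p = (3+θ)/(4 ψ_p(2))`, where `θ` is the solution of `φ_p(θ) = φ_p(2)²`. -/
noncomputable def Cmain {k : ℕ} (p : Fin k → ℝ) (θ : ℝ) : ℝ := (3 + θ) / (4 * psi p 2)

/-- `C̃_p = 1/log(1/p_max)`. -/
noncomputable def Ctilde {k : ℕ} (p : Fin k → ℝ) : ℝ := 1 / Real.log (1 / pmax p)

/-- `C̄_p = max(C̃_p, C_p)`. -/
noncomputable def Cbar {k : ℕ} (p : Fin k → ℝ) (θ : ℝ) : ℝ := max (Ctilde p) (Cmain p θ)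

/-- Strings of length `K` over the alphabet `{0,…,k-1}`. -/
abbrev Str (k K : ℕ) := Fin K → Fin k

/-- Probability of an individual string, all digits i.i.d. with law `p`. -/
noncomputable def strP {k : ℕ} (p : Fin k → ℝ) {K : ℕ} (s : Str k K) : ℝ := ∏ j, p (s j)

/-- Probability of a tuple of `N` i.i.d. `p`-random strings. -/
noncomputable def seqP {k : ℕ} (p : Fin k → ℝ) {N K : ℕ} (ω : Fin N → Str k K) : ℝ :=
  ∏ i, strP p (ω i)

/-- The base-`k` value of a string; comparing these values is exactly the lexicographic
order on strings of the same length. -/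
def lexVal {k K : ℕ} (s : Str k K) : ℕ := ∑ j : Fin K, (s j : ℕ) * k ^ (K - 1 - (j : ℕ))

/-- The lexicographically sorted rearrangement of a tuple of strings. -/
noncomputable def sortedSeq {k N K : ℕ} (ω : Fin N → Str k K) : Fin N → Str k K :=
  fun i => ω (Tuple.sort (fun j => lexVal (ω j)) i)

/-- The edge set of the shuffle graph of a (sorted) sequence of strings: the edge between
`i` and `i+1` is present iff `s i = s (i+1)`; edges are recorded as pairs `(i, i+1)`. -/
def edgeSet {k N K : ℕ} (s : Fin N → Str k K) : Finset (Fin N × Fin N) :=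
  univ.filter (fun e => (e.2 : ℕ) = (e.1 : ℕ) + 1 ∧ s e.1 = s e.2)

/-- `s` begins with two digits equal to `d`. -/
def beginsWith2 {k : ℕ} (d : Fin k) {K : ℕ} (s : Str k K) : Prop :=
  ∃ h : 2 ≤ K, s ⟨0, by omega⟩ = d ∧ s ⟨1, by omega⟩ = d

instance {k K : ℕ} (d : Fin k) (s : Str k K) : Decidable (beginsWith2 d s) :=
  exists_prop_decidable _

/-- `I(p, p^t) = ∑ i, p_i^t log(1/p_i) / φ_p(t)`. -/
noncomputable def Irel {k : ℕ} (p : Fin k → ℝ) (t : ℝ) : ℝ :=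
  ∑ i, p i ^ t * Real.log (1 / p i) / phi p t

/-- The entropy of the probability vector with weights `a i / (∑ j, a j)` (with the
convention `H = 0` when all entries vanish). -/
noncomputable def Hent {k : ℕ} (a : Fin k → ℝ) : ℝ :=
  (∑ i, a i * Real.log ((∑ j, a j) / a i)) / (∑ j, a j)

/-- A string `s` of length `K` is collision-likely (for the data `A, Av, Bv` and the digits
`d0 = 0`, `d1 = 1`): its first `A` digits contain exactly `Av i` digits equal to `i`, its
`(A+1)`-st digit is `0`, its `(A+2)`-nd digit is `1`, and its last `K - A` digits contain
exactly `Bv i` digits equal to `i`. -/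
def CLstr {k : ℕ} (d0 d1 : Fin k) {K : ℕ} (A : ℕ) (Av Bv : Fin k → ℕ) (s : Str k K) : Prop :=
  (∀ i : Fin k, (univ.filter (fun j : Fin K => (j : ℕ) < A ∧ s j = i)).card = Av i) ∧
  (∃ h : A < K, s ⟨A, h⟩ = d0) ∧
  (∃ h : A + 1 < K, s ⟨A + 1, h⟩ = d1) ∧
  (∀ i : Fin k, (univ.filter (fun j : Fin K => A ≤ (j : ℕ) ∧ s j = i)).card = Bv i)

instance {k K : ℕ} (d0 d1 : Fin k) (A : ℕ) (Av Bv : Fin k → ℕ) (s : Str k K) :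
    Decidable (CLstr d0 d1 A Av Bv s) := by
  unfold CLstr; infer_instance

section Occupancy

variable {α : Type*}

lemma sum_prod_weight [Fintype α] (w : α → ℝ) (hw1 : ∑ x, w x = 1) (n : ℕ) :
    ∑ ω : Fin n → α, ∏ i, w (ω i) = 1 := by
  rw [← Fintype.sum_pow, hw1, one_pow]

lemma prob_le_one [Fintype α] (w : α → ℝ) (hw : ∀ x, 0 ≤ w x) (hw1 : ∑ x, w x = 1) (n : ℕ)
    (E : (Fin n → α) → Prop) [DecidablePred E] :
    ∑ ω with E ω, ∏ i, w (ω i) ≤ 1 := by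
  rw [← sum_prod_weight w hw1 n]
  exact sum_le_sum_of_subset_of_nonneg (filter_subset _ _)
    fun ω _ _ => prod_nonneg fun i _ => hw _

lemma card_missed_eq_sum [DecidableEq α] (T : Finset α) {n : ℕ} (ω : Fin n → α) :
    ((T.filter (fun s => ∀ j, ω j ≠ s)).card : ℝ) =
      ∑ s ∈ T, ∏ j, (if ω j ≠ s then (1 : ℝ) else 0) := by
  rw [card_filter]
  push_cast
  refine sum_congr rfl fun s _ => ?_
  rw [prod_ite_zero]
  simp

lemma expect_miss [Fintype α] [DecidableEq α] (w : α → ℝ) (hw1 : ∑ x, w x = 1) (n : ℕ) (s : α) :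
    ∑ ω : Fin n → α, (∏ i, w (ω i)) * ∏ j, (if ω j ≠ s then (1 : ℝ) else 0) =
      (1 - w s) ^ n := by
  have h : ∑ x, w x * (if x ≠ s then (1 : ℝ) else 0) = 1 - w s := by
    have h0 : ∀ x, w x * (if x ≠ s then (1 : ℝ) else 0) =
        w x - (if x = s then w x else 0) := by
      intro x
      by_cases h1 : x = s <;> simp [h1]
    simp only [h0, sum_sub_distrib, hw1, sum_ite_eq', mem_univ, if_true]
  rw [← h, Fintype.sum_pow]
  simp only [prod_mul_distrib]

lemma expect_miss_pair [Fintype α] [DecidableEq α] (w : α → ℝ) (hw1 : ∑ x, w x = 1)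
    (n : ℕ) {s t : α} (hst : s ≠ t) :
    ∑ ω : Fin n → α, (∏ i, w (ω i)) * ((∏ j, (if ω j ≠ s then (1 : ℝ) else 0)) *
      ∏ j, (if ω j ≠ t then (1 : ℝ) else 0)) = (1 - w s - w t) ^ n := by
  have h : ∑ x, w x * ((if x ≠ s then (1 : ℝ) else 0) * (if x ≠ t then (1 : ℝ) else 0)) =
      1 - w s - w t := by
    have h0 : ∀ x, w x * ((if x ≠ s then (1 : ℝ) else 0) * (if x ≠ t then (1 : ℝ) else 0)) =
        w x - (if x = s then w x else 0) - (if x = t then w x else 0) := by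
      intro x
      by_cases h1 : x = s <;> by_cases h2 : x = t <;> simp_all
    simp only [h0, sum_sub_distrib, hw1, sum_ite_eq', mem_univ, if_true]
  rw [← h, Fintype.sum_pow]
  simp only [prod_mul_distrib]

lemma variance_missed_le [Fintype α] [DecidableEq α]
    (w : α → ℝ) (hw : ∀ x, 0 ≤ w x) (hw1 : ∑ x, w x = 1)
    (T : Finset α)
    (q : ℝ) (hq : ∀ s ∈ T, w s = q) (hq0 : 0 ≤ q) (hq1 : q ≤ 1) (n : ℕ) :
    ∑ ω : Fin n → α, (∏ i, w (ω i)) *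
      (((T.filter (fun s => ∀ j, ω j ≠ s)).card : ℝ) - T.card * (1 - q) ^ n) ^ 2 ≤
      T.card * (1 - (1 - q) ^ n) := by
  set a := (1 - q) ^ n with ha
  set M : ℝ := (T.card : ℝ) with hM
  have ha0 : 0 ≤ a := pow_nonneg (by linarith) _
  have ha1 : a ≤ 1 := pow_le_one₀ (by linarith) (by linarith)
  have hM0 : 0 ≤ M := by positivity
  have h1 : ∑ ω : Fin n → α, (∏ i, w (ω i)) *
      ((T.filter (fun s => ∀ j, ω j ≠ s)).card : ℝ) = M * a := by
    simp only [card_missed_eq_sum, mul_sum]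
    rw [sum_comm, sum_congr rfl (g := fun _ => a), sum_const, nsmul_eq_mul]
    intro s hs
    rw [expect_miss w hw1, hq s hs]
  have h2 : ∑ ω : Fin n → α, (∏ i, w (ω i)) *
      ((T.filter (fun s => ∀ j, ω j ≠ s)).card : ℝ) ^ 2 ≤ M * a + (M ^ 2 - M) * a ^ 2 := by
    simp only [card_missed_eq_sum, sq (∑ s ∈ T, _), sum_mul_sum]
    simp only [mul_sum]
    rw [sum_comm]
    have h3 : ∀ s ∈ T, ∑ ω : Fin n → α, ∑ t ∈ T, (∏ i, w (ω i)) *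
        ((∏ j, (if ω j ≠ s then (1 : ℝ) else 0)) * ∏ j, (if ω j ≠ t then (1 : ℝ) else 0)) ≤
        a + (M - 1) * a ^ 2 := by
      intro s hs
      rw [sum_comm, ← add_sum_erase _ _ hs]
      have hdiag : ∑ ω : Fin n → α, (∏ i, w (ω i)) *
          ((∏ j, (if ω j ≠ s then (1 : ℝ) else 0)) * ∏ j, (if ω j ≠ s then (1 : ℝ) else 0)) =
          a := by
        rw [ha, ← hq s hs, ← expect_miss w hw1]
        refine sum_congr rfl fun ω _ => ?_
        rw [← prod_mul_distrib]
        exact congrArg _ (prod_congr rfl fun j _ => by split_ifs <;> simp)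
      have hoff : ∀ t ∈ T.erase s, ∑ ω : Fin n → α, (∏ i, w (ω i)) *
          ((∏ j, (if ω j ≠ s then (1 : ℝ) else 0)) * ∏ j, (if ω j ≠ t then (1 : ℝ) else 0)) ≤
          a ^ 2 := by
        intro t ht
        obtain ⟨hts, htT⟩ := mem_erase.1 ht
        rw [expect_miss_pair w hw1 n hts.symm, hq s hs, hq t htT, ha, ← pow_mul, mul_comm n 2,
          pow_mul]
        refine pow_le_pow_left₀ ?_ (by nlinarith) _
        have : ∑ x ∈ {s, t}, w x ≤ 1 := hw1 ▸ sum_le_sum_of_subset_of_nonneg (subset_univ _)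
          fun x _ _ => hw x
        rw [sum_pair hts.symm, hq s hs, hq t htT] at this
        linarith
      have := sum_le_card_nsmul _ _ _ hoff
      rw [nsmul_eq_mul, cast_card_erase_of_mem hs] at this
      linarith
    have := sum_le_card_nsmul _ _ _ h3
    rw [nsmul_eq_mul] at this
    calc _ ≤ _ := this
      _ = _ := by rw [← hM]; ring
  have h0 := sum_prod_weight w hw1 n
  have hexp : ∑ ω : Fin n → α, (∏ i, w (ω i)) *
      (((T.filter (fun s => ∀ j, ω j ≠ s)).card : ℝ) - M * a) ^ 2 =
      ∑ ω : Fin n → α, (∏ i, w (ω i)) * ((T.filter (fun s => ∀ j, ω j ≠ s)).card : ℝ) ^ 2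
        - 2 * (M * a) * ∑ ω : Fin n → α, (∏ i, w (ω i)) *
          ((T.filter (fun s => ∀ j, ω j ≠ s)).card : ℝ)
        + (M * a) ^ 2 * ∑ ω : Fin n → α, ∏ i, w (ω i) := by
    rw [mul_sum, mul_sum, ← sum_sub_distrib, ← sum_add_distrib]
    exact sum_congr rfl fun ω _ => by ring
  rw [hexp, h1, h0]
  nlinarith [mul_nonneg hM0 (mul_nonneg (sub_nonneg.2 ha1) (sub_nonneg.2 ha1))]

lemma one_sub_pow_le_one_sub_half {q : ℝ} {n : ℕ} (hq0 : 0 ≤ q) (hq1 : q ≤ 1)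
    (hnq : n * q ≤ 1) : (1 - q) ^ n ≤ 1 - n * q / 2 := by
  have h1 : 1 + n * q ≤ (1 + q) ^ n := one_add_mul_le_pow (by linarith) n
  have h2 : (1 - q) ^ n * (1 + q) ^ n ≤ 1 := by
    rw [← mul_pow]
    exact pow_le_one₀ (by nlinarith) (by nlinarith)
  have h3 : 0 ≤ (1 - q) ^ n := pow_nonneg (by linarith) _
  have h4 : 0 ≤ n * q := by positivity
  nlinarith [mul_le_mul_of_nonneg_left h1 h3]

/-- In `n` draws, at least half of the expected number of distinct elements of `T` is hit,
with high probability. -/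
lemma prob_few_hits_le [Fintype α] [DecidableEq α]
    (w : α → ℝ) (hw : ∀ x, 0 ≤ w x) (hw1 : ∑ x, w x = 1)
    (T : Finset α)
    (q : ℝ) (hq : ∀ s ∈ T, w s = q) (hq0 : 0 ≤ q) (hq1 : q ≤ 1) (n : ℕ) (hnq : n * q ≤ 1)
    (x : ℝ) (hx : 0 < x) (hxT : x ≤ T.card * (n * q) / 4) :
    ∑ ω : Fin n → α with ((T.filter (fun s => ∃ j, ω j = s)).card : ℝ) < x, ∏ i, w (ω i) ≤
      2 / x := by
  set a := (1 - q) ^ n with ha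
  set M : ℝ := (T.card : ℝ) with hM
  have hM0 : 0 ≤ M := by positivity
  have hb := one_sub_pow_le_one_sub_half hq0 hq1 hnq
  rw [← ha] at hb
  have hμ : 2 * x ≤ M * (1 - a) := by
    nlinarith [mul_le_mul_of_nonneg_left hb hM0]
  have hcard : ∀ ω : Fin n → α, ((T.filter (fun s => ∀ j, ω j ≠ s)).card : ℝ) =
      M - ((T.filter (fun s => ∃ j, ω j = s)).card : ℝ) := by
    intro ω
    have := card_filter_add_card_filter_not (s := T) (fun s : α => ∃ j, ω j = s)
    simp only [not_exists] at this
    rw [eq_sub_iff_add_eq, hM, ← this]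
    push_cast
    ring
  have hvar := variance_missed_le w hw hw1 T q hq hq0 hq1 n
  rw [← ha, ← hM] at hvar
  set S := ∑ ω : Fin n → α with ((T.filter (fun s => ∃ j, ω j = s)).card : ℝ) < x,
    ∏ i, w (ω i) with hS
  have hlow : S * (M * (1 - a) / 2) ^ 2 ≤ M * (1 - a) := by
    refine le_trans ?_ hvar
    rw [hS, sum_mul]
    refine (sum_le_sum fun ω hω => ?_).trans (sum_le_sum_of_subset_of_nonneg (subset_univ _)
      fun ω _ _ => mul_nonneg (prod_nonneg fun i _ => hw _) (sq_nonneg _))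
    have hω' := (mem_filter.1 hω).2
    refine mul_le_mul_of_nonneg_left ?_ (prod_nonneg fun i _ => hw _)
    rw [hcard]
    refine pow_le_pow_left₀ (by linarith) ?_ 2
    linarith
  have hpos : 0 < M * (1 - a) := by linarith
  have hS' : S * (M * (1 - a)) ≤ 4 := by
    have : S * (M * (1 - a)) * (M * (1 - a)) ≤ 4 * (M * (1 - a)) := by nlinarith
    exact le_of_mul_le_mul_right this hpos
  have hS0 : 0 ≤ S := sum_nonneg fun ω _ => prod_nonneg fun i _ => hw _
  rw [le_div_iff₀ hx]
  nlinarith [mul_le_mul_of_nonneg_left hμ hS0]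

/-- Splitting the draws into two batches, many elements of `T` are hit in both of them. -/
lemma prob_few_double_hits_le [Fintype α] [DecidableEq α]
    (w : α → ℝ) (hw : ∀ x, 0 ≤ w x) (hw1 : ∑ x, w x = 1)
    (T : Finset α) (q : ℝ) (hq : ∀ s ∈ T, w s = q) (hq0 : 0 ≤ q) (hq1 : q ≤ 1) (m n : ℕ)
    (hmq : m * q ≤ 1) (hnq : n * q ≤ 1)
    (x : ℝ) (hx : 0 < x) (hxT : x ≤ T.card * (m * q) * (n * q) / 16) :
    ∑ ω : Fin (m + n) → α with
        ((T.filter (fun s => 2 ≤ (univ.filter (fun j => ω j = s)).card)).card : ℝ) < x,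
      ∏ i, w (ω i) ≤ 4 / x := by
  classical
  set y : ℝ := T.card * (m * q) / 4 with hy
  have hxy : x ≤ y * (n * q) / 4 := by rw [hy]; linarith
  have hy0 : 0 ≤ y := by positivity
  have hxy' : x ≤ y := by nlinarith
  have hypos : 0 < y := by linarith
  have key : ∀ (f : Fin m → α) (g : Fin n → α),
      ((T.filter (fun s => ∃ j, f j = s)).filter (fun s => ∃ j, g j = s)).card ≤
      (T.filter (fun s => 2 ≤ (univ.filter (fun j => Fin.append f g j = s)).card)).card := by
    intro f g
    refine card_le_card fun s hs => ?_
    simp only [mem_filter] at hs ⊢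
    obtain ⟨⟨hsT, i, hi⟩, j, hj⟩ := hs
    refine ⟨hsT, Finset.one_lt_card.2 ⟨Fin.castAdd n i, by simp [hi], Fin.natAdd m j,
      by simp [hj], ?_⟩⟩
    intro h
    have h1 := congrArg Fin.val h
    simp at h1
    omega
  have hP : ∀ {l : ℕ} (f : Fin l → α), 0 ≤ ∏ i, w (f i) := fun f => prod_nonneg fun i _ => hw _
  rw [sum_filter, ← (Fin.appendEquiv m n).sum_comp, Fintype.sum_prod_type]
  have hsplit : ∀ f : Fin m → α,
      ∑ g : Fin n → α, (if ((T.filter (fun s => 2 ≤ (univ.filter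
          (fun j => Fin.appendEquiv m n (f, g) j = s)).card)).card : ℝ) < x
        then ∏ i, w (Fin.appendEquiv m n (f, g) i) else 0) ≤
      (if ((T.filter (fun s => ∃ j, f j = s)).card : ℝ) < y then ∏ i, w (f i) else 0) +
        (∏ i, w (f i)) * (2 / x) := by
    intro f
    set U := T.filter (fun s => ∃ j, f j = s) with hU
    have hprod : ∀ g : Fin n → α, ∏ i, w (Fin.appendEquiv m n (f, g) i) =
        (∏ i, w (f i)) * ∏ i, w (g i) := by
      intro g
      simp [Fin.appendEquiv, Fin.prod_univ_add]
    simp only [hprod]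
    split_ifs with hlt
    · have : ∑ g : Fin n → α, (if ((T.filter (fun s => 2 ≤ (univ.filter
          (fun j => Fin.appendEquiv m n (f, g) j = s)).card)).card : ℝ) < x
          then (∏ i, w (f i)) * ∏ i, w (g i) else 0) ≤
          ∑ g : Fin n → α, (∏ i, w (f i)) * ∏ i, w (g i) := by
        refine sum_le_sum fun g _ => ?_
        split_ifs
        · exact le_rfl
        · exact mul_nonneg (hP f) (hP g)
      rw [← mul_sum, sum_prod_weight w hw1, mul_one] at this
      have h2 : 0 ≤ (∏ i, w (f i)) * (2 / x) := mul_nonneg (hP f) (by positivity)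
      linarith
    · rw [zero_add]
      push Not at hlt
      have hU2 := prob_few_hits_le w hw hw1 U q (fun s hs => hq s (mem_filter.1 hs).1) hq0 hq1 n
        hnq x hx (hxy.trans (by gcongr))
      rw [sum_filter] at hU2
      refine le_trans ?_ (mul_le_mul_of_nonneg_left hU2 (hP f))
      rw [mul_sum]
      refine sum_le_sum fun g _ => ?_
      by_cases hc : ((T.filter (fun s => 2 ≤ (univ.filter
          (fun j => Fin.appendEquiv m n (f, g) j = s)).card)).card : ℝ) < x
      · have hk : ((U.filter (fun s => ∃ j, g j = s)).card : ℝ) < x :=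
          lt_of_le_of_lt (by exact_mod_cast key f g) hc
        rw [if_pos hc, if_pos hk]
      · rw [if_neg hc]
        split_ifs
        · exact mul_nonneg (hP f) (hP g)
        · simp
  refine (sum_le_sum fun f _ => hsplit f).trans ?_
  rw [sum_add_distrib, ← sum_filter, ← sum_mul, sum_prod_weight w hw1, one_mul]
  have h1 := prob_few_hits_le w hw hw1 T q hq hq0 hq1 m hmq y hypos le_rfl
  have h2 : 2 / y ≤ 2 / x := by gcongr
  have h3 : 4 / x = 2 / x + 2 / x := by ring
  linarith

lemma one_sub_le_prob_many_repeats [Fintype α] [DecidableEq α]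
    (w : α → ℝ) (hw : ∀ x, 0 ≤ w x) (hw1 : ∑ x, w x = 1)
    (T : Finset α) (q : ℝ) (hq : ∀ s ∈ T, w s = q) (hq0 : 0 ≤ q) (N : ℕ) (hN : 2 ≤ N)
    (hNq : N * q ≤ 1) (x y : ℝ) (hx : 0 < x) (hxT : x ≤ T.card * (N * q) ^ 2 / 128)
    (hyx : y ≤ x) :
    1 - 4 / x ≤ ∑ ω : Fin N → α with
        y ≤ ((T.filter (fun s => 2 ≤ (univ.filter (fun j => ω j = s)).card)).card : ℝ),
      ∏ i, w (ω i) := by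
  obtain ⟨m, n, rfl, hm, hn⟩ : ∃ m n : ℕ, N = m + n ∧ N ≤ 4 * m ∧ N ≤ 2 * n :=
    ⟨N / 2, N - N / 2, by omega, by omega, by omega⟩
  have hm' : ((m + n : ℕ) : ℝ) ≤ 4 * m := by exact_mod_cast hm
  have hn' : ((m + n : ℕ) : ℝ) ≤ 2 * n := by exact_mod_cast hn
  have hN' : (2 : ℝ) ≤ ((m + n : ℕ) : ℝ) := by exact_mod_cast hN
  have hcast : ((m + n : ℕ) : ℝ) = m + n := by push_cast; ring
  have hmn : ((m + n : ℕ) : ℝ) ^ 2 ≤ 8 * (m * n) := by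
    nlinarith [mul_le_mul hm' hn' (by positivity) (by positivity)]
  have h := prob_few_double_hits_le w hw hw1 T q hq hq0 (by nlinarith) m n
    (by rw [hcast] at hNq; nlinarith [mul_nonneg (Nat.cast_nonneg (α := ℝ) n) hq0])
    (by rw [hcast] at hNq; nlinarith [mul_nonneg (Nat.cast_nonneg (α := ℝ) m) hq0]) x hx
    (hxT.trans (by
      rw [mul_pow]
      have := mul_le_mul_of_nonneg_left hmn
        (mul_nonneg (Nat.cast_nonneg (α := ℝ) T.card) (sq_nonneg q))
      nlinarith))
  have htot := sum_filter_add_sum_filter_not univ (fun ω : Fin (m + n) → α =>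
    ((T.filter (fun s => 2 ≤ (univ.filter (fun j => ω j = s)).card)).card : ℝ) < x)
    (fun ω => ∏ i, w (ω i))
  rw [sum_prod_weight w hw1] at htot
  refine le_trans (by linarith) (sum_le_sum_of_subset_of_nonneg
    (s := univ.filter (fun ω : Fin (m + n) → α => ¬
      ((T.filter (fun s => 2 ≤ (univ.filter (fun j => ω j = s)).card)).card : ℝ) < x))
    (fun ω hω => ?_)
    fun ω _ _ => prod_nonneg fun i _ => hw _)
  rw [mem_filter] at hω ⊢
  exact ⟨mem_univ _, hyx.trans (not_lt.1 hω.2)⟩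

end Occupancy

section Counting

/-- There are `n! / ∏ i, (v i)!` words of length `n` in which each letter `i` occurs `v i`
times. -/
lemma card_words_mul_prod_factorial {k : ℕ} (n : ℕ) (v : Fin k → ℕ) (hv : ∑ i, v i = n) :
    (univ.filter (fun f : Fin n → Fin k =>
      ∀ i, (univ.filter (fun j => f j = i)).card = v i)).card * ∏ i, (v i).factorial =
      n.factorial := by
  induction n generalizing v with
  | zero =>
    have h0 : ∀ i, v i = 0 := by simpa using hv
    simp [h0]
  | succ n ih =>
    have hcount : ∀ (a : Fin k) (f : Fin n → Fin k) (i : Fin k),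
        (univ.filter (fun j => (Fin.cons a f : Fin (n + 1) → Fin k) j = i)).card =
          (if a = i then 1 else 0) + (univ.filter (fun j => f j = i)).card := by
      intro a f i
      rw [card_filter, Fin.sum_univ_succ, card_filter]
      simp
    have hfib : ∀ a : Fin k,
        (univ.filter (fun f : Fin n → Fin k =>
          ∀ i, (univ.filter (fun j => (Fin.cons a f : Fin (n + 1) → Fin k) j = i)).card =
            v i)).card * ∏ i, (v i).factorial = v a * n.factorial := by
      intro a
      simp only [hcount]
      rcases Nat.eq_zero_or_pos (v a) with h0 | hpos
      · rw [h0, zero_mul, filter_false_of_mem, card_empty, zero_mul]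
        intro f _ h
        have := h a
        rw [if_pos rfl] at this
        omega
      · have hu : ∀ i, Function.update v a (v a - 1) i + (if a = i then 1 else 0) = v i := by
          intro i
          by_cases h : a = i
          · subst h
            simp only [Function.update_self, if_true]
            omega
          · rw [Function.update_of_ne (Ne.symm h), if_neg h, add_zero]
        have hsum : ∑ i, Function.update v a (v a - 1) i = n := by
          have := sum_congr (rfl : (univ : Finset (Fin k)) = univ) fun i _ => hu i
          rw [sum_add_distrib, hv, sum_ite_eq, if_pos (mem_univ _)] at this
          omega
        rw [← ih _ hsum, ← mul_prod_erase _ _ (mem_univ a),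
          ← mul_prod_erase _ (fun i => (Function.update v a (v a - 1) i).factorial) (mem_univ a)]
        have hfilt : (univ.filter (fun f : Fin n → Fin k =>
            ∀ i, (if a = i then 1 else 0) + (univ.filter (fun j => f j = i)).card = v i)) =
            univ.filter (fun f : Fin n → Fin k =>
              ∀ i, (univ.filter (fun j => f j = i)).card =
                Function.update v a (v a - 1) i) := by
          refine filter_congr fun f _ => forall_congr' fun i => ?_
          have := hu i
          omega
        have hprod : ∏ i ∈ univ.erase a, (Function.update v a (v a - 1) i).factorial =
            ∏ i ∈ univ.erase a, (v i).factorial :=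
          prod_congr rfl fun i hi => by rw [Function.update_of_ne (mem_erase.1 hi).1]
        rw [hfilt, hprod, Function.update_self, ← Nat.mul_factorial_pred (by omega : v a ≠ 0)]
        ring
    have hcard : (univ.filter (fun f : Fin (n + 1) → Fin k =>
        ∀ i, (univ.filter (fun j => f j = i)).card = v i)).card =
        ∑ a, (univ.filter (fun f : Fin n → Fin k =>
          ∀ i, (univ.filter (fun j => (Fin.cons a f : Fin (n + 1) → Fin k) j = i)).card =
            v i)).card := by
      simp only [card_filter _ (univ : Finset (Fin (n + 1) → Fin k)),
        card_filter _ (univ : Finset (Fin n → Fin k))]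
      rw [← (Fin.consEquiv (fun _ => Fin k)).sum_comp, Fintype.sum_prod_type]
      rfl
    rw [hcard, sum_mul, sum_congr rfl fun a _ => hfib a, ← sum_mul, hv, Nat.factorial_succ]

lemma factorial_mul_le_card_CLstr {k K A B : ℕ} {d0 d1 : Fin k} (hd : d0 ≠ d1)
    (hK : K = A + (B + 2)) (Av Bv : Fin k → ℕ) (hA : ∑ i, Av i = A) (hB : ∑ i, Bv i = B + 2)
    (h0 : 1 ≤ Bv d0) (h1 : 1 ≤ Bv d1) :
    A.factorial * B.factorial ≤
      (univ.filter (fun s : Str k K => CLstr d0 d1 A Av Bv s)).card *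
        ((∏ i, (Av i).factorial) * ∏ i, (Bv i).factorial) := by
  subst hK
  set Bv' : Fin k → ℕ := fun i => Bv i - ((if d0 = i then 1 else 0) + if d1 = i then 1 else 0)
    with hBv'
  have hle : ∀ i, Bv' i + ((if d0 = i then 1 else 0) + if d1 = i then 1 else 0) = Bv i := by
    intro i
    simp only [hBv']
    by_cases e0 : d0 = i <;> by_cases e1 : d1 = i
    · exact absurd (e0.trans e1.symm) hd
    all_goals simp only [e0, e1, if_true, if_false]
    · subst e0; omega
    · subst e1; omega
    · omega
  have hsum : ∑ i, Bv' i = B := by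
    have := sum_congr (rfl : (univ : Finset (Fin k)) = univ) fun i _ => hle i
    rw [sum_add_distrib, sum_add_distrib, hB, sum_ite_eq, sum_ite_eq, if_pos (mem_univ _),
      if_pos (mem_univ _)] at this
    omega
  set F := univ.filter (fun f : Fin A → Fin k =>
    ∀ i, (univ.filter (fun j => f j = i)).card = Av i) with hF
  set G := univ.filter (fun f : Fin B → Fin k =>
    ∀ i, (univ.filter (fun j => f j = i)).card = Bv' i) with hG
  have hcard : F.card * G.card ≤
      (univ.filter (fun s : Str k (A + (B + 2)) => CLstr d0 d1 A Av Bv s)).card := by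
    rw [← card_product]
    refine card_le_card_of_injOn (fun fg => Fin.append fg.1
      (Fin.cons d0 (Fin.cons d1 fg.2 : Fin (B + 1) → Fin k) : Fin (B + 2) → Fin k)) ?_ ?_
    · rintro ⟨f, g⟩ hfg
      rw [mem_coe, mem_product, hF, hG, mem_filter, mem_filter] at hfg
      rw [mem_coe, mem_filter]
      refine ⟨mem_univ _, fun i => ?_, ⟨by omega, ?_⟩, ⟨by omega, ?_⟩, fun i => ?_⟩
      · rw [← hfg.1.2 i, card_filter, card_filter, Fin.sum_univ_add]
        simp
      · have : (⟨A, by omega⟩ : Fin (A + (B + 2))) = Fin.natAdd A 0 := by ext; simp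
        rw [this]
        exact Fin.append_right _ _ _
      · have : (⟨A + 1, by omega⟩ : Fin (A + (B + 2))) = Fin.natAdd A 1 := by ext; simp
        rw [this]
        exact Fin.append_right _ _ _
      · rw [← hle i, ← hfg.2.2 i, card_filter, card_filter, Fin.sum_univ_add,
          Fin.sum_univ_succ, Fin.sum_univ_succ]
        have hlt : ∀ x : Fin A, ¬ A ≤ (x : ℕ) := fun x => not_le.2 x.2
        simp [hlt]
        ring
    · rintro ⟨f, g⟩ _ ⟨f', g'⟩ _ h
      have h1 := (Fin.appendEquiv A (B + 2)).injective
        (a₁ := (f, Fin.cons d0 (Fin.cons d1 g : Fin (B + 1) → Fin k)))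
        (a₂ := (f', Fin.cons d0 (Fin.cons d1 g' : Fin (B + 1) → Fin k))) h
      rw [Prod.mk.injEq] at h1
      rw [h1.1, Fin.cons_right_injective _ (Fin.cons_right_injective _ h1.2)]
  have hfac : ∏ i, (Bv' i).factorial ≤ ∏ i, (Bv i).factorial :=
    prod_le_prod' fun i _ => Nat.factorial_le (Nat.sub_le _ _)
  calc A.factorial * B.factorial
      = (F.card * G.card) * ((∏ i, (Av i).factorial) * ∏ i, (Bv' i).factorial) := by
        rw [← card_words_mul_prod_factorial A Av hA, ← card_words_mul_prod_factorial B Bv' hsum]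
        ring
    _ ≤ _ := by gcongr

lemma strP_eq_of_CLstr {k K A : ℕ} (p : Fin k → ℝ) {d0 d1 : Fin k} {Av Bv : Fin k → ℕ}
    {s : Str k K} (hs : CLstr d0 d1 A Av Bv s) : strP p s = ∏ i, p i ^ (Av i + Bv i) := by
  rw [strP, ← prod_fiberwise univ s]
  refine prod_congr rfl fun i _ => ?_
  rw [prod_congr rfl (g := fun _ => p i) fun j hj => by rw [(mem_filter.1 hj).2], prod_const,
    ← hs.1 i, ← hs.2.2.2 i, ← card_union_of_disjoint]
  · congr 2
    ext j
    simp only [mem_filter, mem_univ, true_and, mem_union]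
    have := lt_or_ge (j : ℕ) A
    tauto
  · rw [disjoint_left]
    intro j hj hj'
    rw [mem_filter] at hj hj'
    omega

lemma sum_strP {k : ℕ} (p : Fin k → ℝ) (hsum : ∑ i, p i = 1) (K : ℕ) :
    ∑ s : Str k K, strP p s = 1 := by
  simp only [strP]
  rw [← Fintype.sum_pow, hsum, one_pow]

end Counting

section Entropy

lemma sub_le_log_factorial (n : ℕ) :
    n * Real.log n - n ≤ Real.log (n.factorial : ℝ) := by
  rcases Nat.eq_zero_or_pos n with rfl | hn
  · simp
  · have h1 := Stirling.le_log_factorial_stirling hn.ne'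
    have h2 : 0 ≤ Real.log n := Real.log_natCast_nonneg n
    have h3 : 0 ≤ Real.log (2 * Real.pi) := Real.log_nonneg (by linarith [Real.pi_gt_three])
    linarith

lemma log_factorial_le (n : ℕ) :
    Real.log (n.factorial : ℝ) ≤ n * Real.log n - n + (Real.log n + 1) := by
  induction n with
  | zero => simp
  | succ n ih =>
    rcases Nat.eq_zero_or_pos n with rfl | hn
    · simp
    have hn' : (0 : ℝ) < n := by exact_mod_cast hn
    rw [Nat.factorial_succ]
    push_cast
    rw [Real.log_mul (by positivity) (by positivity)]
    have h1 := Real.one_sub_inv_le_log_of_pos (show (0 : ℝ) < (n + 1) / n by positivity)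
    rw [inv_div, Real.log_div (by positivity) (by positivity)] at h1
    have h2 : 1 - (n : ℝ) / (n + 1) = 1 / (n + 1) := by field_simp; ring
    rw [h2, div_le_iff₀ (by positivity)] at h1
    linarith

lemma Hent_eq_sum_negMulLog {k : ℕ} (a : Fin k → ℝ) :
    Hent a = ∑ i, Real.negMulLog (a i / ∑ j, a j) := by
  rw [Hent, sum_div]
  refine sum_congr rfl fun i _ => ?_
  rw [Real.negMulLog, ← inv_div (a i), Real.log_inv]
  ring

lemma entropy_le_log_factorial_sub {k n : ℕ} (v : Fin k → ℕ) (hv : ∑ i, v i = n) :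
    (n : ℝ) * Hent (fun i => (v i : ℝ)) - k * (Real.log (n + 1) + 1) ≤
      Real.log (n.factorial : ℝ) - ∑ i, Real.log ((v i).factorial : ℝ) := by
  have hv' : ∑ i, (v i : ℝ) = n := by exact_mod_cast hv
  have h1 : (n : ℝ) * Hent (fun i => (v i : ℝ)) =
      n * Real.log n - ∑ i, (v i : ℝ) * Real.log (v i) := by
    rw [Hent]
    simp only [hv']
    rcases Nat.eq_zero_or_pos n with rfl | hn
    · have : ∀ i, v i = 0 := by simpa using hv
      simp [this]
    · have hn' : (n : ℝ) ≠ 0 := by positivity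
      rw [mul_div_cancel₀ _ hn']
      nth_rewrite 2 [← hv']
      rw [sum_mul, ← sum_sub_distrib]
      refine sum_congr rfl fun i _ => ?_
      rcases Nat.eq_zero_or_pos (v i) with h | h
      · simp [h]
      · rw [Real.log_div hn' (by positivity)]
        ring
  have h2 : ∑ i, Real.log ((v i).factorial : ℝ) ≤
      ∑ i, ((v i : ℝ) * Real.log (v i) - v i + (Real.log (n + 1) + 1)) := by
    refine sum_le_sum fun i _ => (log_factorial_le _).trans ?_
    have : v i ≤ n := hv ▸ single_le_sum (fun _ _ => Nat.zero_le _) (mem_univ i)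
    have : (v i : ℝ) ≤ n := by exact_mod_cast this
    have : Real.log (v i : ℝ) ≤ Real.log (n + 1) := by
      rcases Nat.eq_zero_or_pos (v i) with h | h
      · rw [h, Nat.cast_zero, Real.log_zero]
        exact Real.log_nonneg (by linarith [Nat.cast_nonneg (α := ℝ) n])
      · exact Real.log_le_log (by positivity) (by linarith)
    linarith
  rw [sum_add_distrib, sum_sub_distrib, hv', sum_const, card_univ, Fintype.card_fin,
    nsmul_eq_mul] at h2
  have h3 := sub_le_log_factorial n
  linarith

lemma entropy_le_log_card_CLstr {k K A : ℕ} {d0 d1 : Fin k} (hd : d0 ≠ d1)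
    (hAK : A ≤ K) (Av Bv : Fin k → ℕ) (hA : ∑ i, Av i = A) (hB : ∑ i, Bv i = K - A)
    (h0 : 1 ≤ Bv d0) (h1 : 1 ≤ Bv d1) :
    0 < (univ.filter (fun s : Str k K => CLstr d0 d1 A Av Bv s)).card ∧
    (A : ℝ) * Hent (fun i => (Av i : ℝ)) + ((K - A : ℕ) : ℝ) * Hent (fun i => (Bv i : ℝ)) -
        (2 * k * (Real.log (K + 1) + 1) + 2 * Real.log (K + 1)) ≤
      Real.log (univ.filter (fun s : Str k K => CLstr d0 d1 A Av Bv s)).card := by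
  have h2 : 2 ≤ K - A := by
    rw [← hB]
    calc 2 ≤ ∑ i ∈ {d0, d1}, Bv i := by rw [sum_pair hd]; omega
      _ ≤ _ := sum_le_sum_of_subset (subset_univ _)
  obtain ⟨B, hBK⟩ : ∃ B, K - A = B + 2 := ⟨K - A - 2, by omega⟩
  have hcnt := factorial_mul_le_card_CLstr hd (by omega : K = A + (B + 2)) Av Bv hA
    (by omega) h0 h1
  set M := (univ.filter (fun s : Str k K => CLstr d0 d1 A Av Bv s)).card with hM
  have hMpos : 0 < M := by
    by_contra hM0
    have : M = 0 := by omega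
    rw [this, zero_mul] at hcnt
    have := Nat.mul_pos A.factorial_pos B.factorial_pos
    omega
  refine ⟨hMpos, ?_⟩
  have hfac : (K - A).factorial ≤ (K + 1) ^ 2 * B.factorial := by
    rw [hBK, Nat.factorial_succ, Nat.factorial_succ, ← mul_assoc, sq]
    gcongr <;> omega
  have hcnt' : A.factorial * (K - A).factorial ≤
      (K + 1) ^ 2 * (M * ((∏ i, (Av i).factorial) * ∏ i, (Bv i).factorial)) := by
    calc A.factorial * (K - A).factorial ≤ A.factorial * ((K + 1) ^ 2 * B.factorial) := by
          gcongr
      _ = (K + 1) ^ 2 * (A.factorial * B.factorial) := by ring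
      _ ≤ _ := by gcongr
  have hlog := Real.log_le_log (by positivity) (by exact_mod_cast hcnt' :
    (A.factorial : ℝ) * ((K - A).factorial : ℝ) ≤ ((K : ℝ) + 1) ^ 2 *
      (M * ((∏ i, ((Av i).factorial : ℝ)) * ∏ i, ((Bv i).factorial : ℝ))))
  have hM' : (M : ℝ) ≠ 0 := by positivity
  have hp1 : ∏ i, ((Av i).factorial : ℝ) ≠ 0 := by positivity
  have hp2 : ∏ i, ((Bv i).factorial : ℝ) ≠ 0 := by positivity
  rw [Real.log_mul (by positivity) (by positivity), Real.log_mul (by positivity) (by positivity),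
    Real.log_mul hM' (by positivity), Real.log_mul hp1 hp2,
    Real.log_prod (fun i _ => by positivity), Real.log_prod (fun i _ => by positivity),
    Real.log_pow] at hlog
  have hEA := entropy_le_log_factorial_sub Av hA
  have hEB := entropy_le_log_factorial_sub Bv hB
  have hlA : Real.log ((A : ℝ) + 1) ≤ Real.log (K + 1) := by gcongr
  have hlB : Real.log (((K - A : ℕ) : ℝ) + 1) ≤ Real.log (K + 1) := by
    gcongr
    omega
  have hkA := mul_le_mul_of_nonneg_left hlA (Nat.cast_nonneg (α := ℝ) k)
  have hkB := mul_le_mul_of_nonneg_left hlB (Nat.cast_nonneg (α := ℝ) k)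
  push_cast at hlog
  linarith

end Entropy

section Exponents

variable {k : ℕ} {p : Fin k → ℝ}

lemma lt_one_of_sum_eq_one (hk : 2 ≤ k) (hpos : ∀ i, 0 < p i) (hsum : ∑ i, p i = 1)
    (i : Fin k) : p i < 1 := by
  obtain ⟨j, hj⟩ : ∃ j : Fin k, j ≠ i :=
    haveI : Nontrivial (Fin k) := Fin.nontrivial_iff_two_le.2 hk
    exists_ne i
  have : ∑ x ∈ {i, j}, p x ≤ 1 := hsum ▸ sum_le_sum_of_subset_of_nonneg (subset_univ _)
    fun x _ _ => (hpos x).le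
  rw [sum_pair hj.symm] at this
  linarith [hpos j]

lemma le_pmax (p : Fin k → ℝ) (i : Fin k) : p i ≤ pmax p :=
  le_ciSup (Set.finite_range p).bddAbove i

lemma exists_eq_pmax (hk : 2 ≤ k) (p : Fin k → ℝ) : ∃ i, p i = pmax p :=
  haveI : Nonempty (Fin k) := ⟨⟨0, by omega⟩⟩
  exists_eq_ciSup_of_finite

lemma phi_pos (hk : 2 ≤ k) (hpos : ∀ i, 0 < p i) (t : ℝ) : 0 < phi p t :=
  haveI : Nonempty (Fin k) := ⟨⟨0, by omega⟩⟩
  sum_pos (fun i _ => Real.rpow_pos_of_pos (hpos i) _) univ_nonempty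

lemma phi_two_lt_one (hk : 2 ≤ k) (hpos : ∀ i, 0 < p i) (hsum : ∑ i, p i = 1) :
    phi p 2 < 1 := by
  have : Nonempty (Fin k) := ⟨⟨0, by omega⟩⟩
  rw [← hsum, phi]
  refine sum_lt_sum_of_nonempty univ_nonempty fun i _ => ?_
  rw [Real.rpow_two]
  nlinarith [hpos i, lt_one_of_sum_eq_one hk hpos hsum i]

lemma psi_two_pos (hk : 2 ≤ k) (hpos : ∀ i, 0 < p i) (hsum : ∑ i, p i = 1) : 0 < psi p 2 :=
  neg_pos.2 (Real.log_neg (phi_pos hk hpos 2) (phi_two_lt_one hk hpos hsum))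

lemma log_one_div_pmax_pos (hk : 2 ≤ k) (hpos : ∀ i, 0 < p i) (hsum : ∑ i, p i = 1) :
    0 < Real.log (1 / pmax p) := by
  obtain ⟨i, hi⟩ := exists_eq_pmax hk p
  rw [← hi]
  exact Real.log_pos (by
    rw [lt_div_iff₀ (hpos i), one_mul]
    exact lt_one_of_sum_eq_one hk hpos hsum i)

lemma psi_two_le (hk : 2 ≤ k) (hpos : ∀ i, 0 < p i) :
    psi p 2 ≤ 2 * Real.log (1 / pmax p) := by
  obtain ⟨i, hi⟩ := exists_eq_pmax hk p
  have h1 : p i ^ 2 ≤ phi p 2 := by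
    rw [phi, ← Real.rpow_two]
    exact single_le_sum (f := fun i => p i ^ (2 : ℝ))
      (fun j _ => (Real.rpow_pos_of_pos (hpos j) _).le) (mem_univ i)
  have h2 := Real.log_le_log (pow_pos (hpos i) 2) h1
  rw [Real.log_pow] at h2
  rw [psi, ← hi, one_div, Real.log_inv]
  push_cast at h2
  linarith

lemma log_le_Irel (hk : 2 ≤ k) (hpos : ∀ i, 0 < p i) (t : ℝ) :
    Real.log (1 / pmax p) ≤ Irel p t := by
  have h1 := phi_pos hk hpos t
  rw [Irel, ← sum_div, le_div_iff₀ h1, mul_comm, phi, sum_mul]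
  refine sum_le_sum fun i _ => mul_le_mul_of_nonneg_left ?_ (Real.rpow_pos_of_pos (hpos i) _).le
  have hm := le_pmax p i
  have := hpos i
  exact Real.log_le_log (one_div_pos.2 (by linarith)) (one_div_le_one_div_of_le this hm)

lemma three_le_of_phi_eq (hk : 2 ≤ k) (hpos : ∀ i, 0 < p i) (hsum : ∑ i, p i = 1) {θ : ℝ}
    (hθ : phi p θ = phi p 2 ^ 2) : 3 ≤ θ := by
  have : Nonempty (Fin k) := ⟨⟨0, by omega⟩⟩
  by_contra! hlt
  have h1 : phi p 3 < phi p θ := sum_lt_sum_of_nonempty univ_nonempty fun i _ =>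
    Real.rpow_lt_rpow_of_exponent_gt (hpos i) (lt_one_of_sum_eq_one hk hpos hsum i) hlt
  have h2 : (∑ i, p i ^ (2 : ℝ)) ^ 2 ≤ (∑ i, p i) * ∑ i, p i ^ (3 : ℝ) := by
    refine sum_sq_le_sum_mul_sum_of_sq_le_mul _ (fun i _ => (hpos i).le)
      (fun i _ => (Real.rpow_pos_of_pos (hpos i) _).le) fun i _ => le_of_eq ?_
    have h3 : p i ^ (3 : ℝ) = p i ^ 3 := by exact_mod_cast Real.rpow_natCast (p i) 3
    rw [Real.rpow_two, h3]
    ring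
  rw [hsum, one_mul] at h2
  change phi p 2 ^ 2 ≤ phi p 3 at h2
  linarith

lemma sum_tilted_mul_log (t : ℝ) :
    ∑ i, p i ^ t / phi p t * Real.log (p i) = - Irel p t := by
  rw [Irel, ← sum_neg_distrib]
  refine sum_congr rfl fun i _ => ?_
  rw [one_div, Real.log_inv]
  ring

lemma sum_negMulLog_tilted (hk : 2 ≤ k) (hpos : ∀ i, 0 < p i) (t : ℝ) :
    ∑ i, Real.negMulLog (p i ^ t / phi p t) = t * Irel p t - psi p t := by
  have hφ := phi_pos hk hpos t
  have h : ∀ i, Real.negMulLog (p i ^ t / phi p t) =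
      -t * (p i ^ t / phi p t * Real.log (p i)) + p i ^ t / phi p t * Real.log (phi p t) := by
    intro i
    rw [Real.negMulLog, Real.log_div (Real.rpow_pos_of_pos (hpos i) t).ne' hφ.ne',
      Real.log_rpow (hpos i)]
    ring
  have h1 : ∑ i, p i ^ t / phi p t = 1 := by
    rw [← sum_div]
    exact div_self hφ.ne'
  simp only [h]
  rw [sum_add_distrib, ← mul_sum, ← sum_mul, sum_tilted_mul_log, h1, psi]
  ring

lemma psi_eq_two_mul (hθ : phi p θ = phi p 2 ^ 2) : psi p θ = 2 * psi p 2 := by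
  rw [psi, psi, hθ, Real.log_pow]
  push_cast
  ring

/-- The limit of the exponent `γ` is positive. -/
lemma limit_exponent_pos (hk : 2 ≤ k) (hpos : ∀ i, 0 < p i) (hsum : ∑ i, p i = 1) {θ ε δ : ℝ}
    (hθ : phi p θ = phi p 2 ^ 2) (hε : 0 < ε) (hδ0 : 0 ≤ δ)
    (hδ : δ * (θ - 2) ≤ ε * psi p 2) :
    0 < 2 + 2 * (∑ i, ((1 - δ) / (2 * Irel p θ) * (p i ^ θ / phi p θ) +
        (Cmain p θ - ε - (1 - δ) / (2 * Irel p θ)) * (p i ^ 2 / phi p 2)) * Real.log (p i)) +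
      (1 - δ) / (2 * Irel p θ) * ∑ i, Real.negMulLog (p i ^ θ / phi p θ) +
      (Cmain p θ - ε - (1 - δ) / (2 * Irel p θ)) *
        ∑ i, Real.negMulLog (p i ^ 2 / phi p 2) := by
  have hψ := psi_two_pos hk hpos hsum
  have hL := log_one_div_pmax_pos hk hpos hsum
  have hIL := log_le_Irel hk hpos θ
  have hψL := psi_two_le hk hpos
  have h3 := three_le_of_phi_eq hk hpos hsum hθ
  have hI : 0 < Irel p θ := hL.trans_le hIL
  set a := (1 - δ) / (2 * Irel p θ) with ha
  set b := Cmain p θ - ε - a with hb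
  have e1 := sum_negMulLog_tilted hk hpos θ
  have e2 := sum_negMulLog_tilted hk hpos 2
  have e3 := sum_tilted_mul_log (p := p) θ
  have e4 := sum_tilted_mul_log (p := p) 2
  simp only [Real.rpow_two] at e2 e4
  have e5 : ∑ i, (a * (p i ^ θ / phi p θ) + b * (p i ^ 2 / phi p 2)) * Real.log (p i) =
      a * (- Irel p θ) + b * (- Irel p 2) := by
    rw [← e3, ← e4, mul_sum, mul_sum, ← sum_add_distrib]
    exact sum_congr rfl fun i _ => by ring
  rw [e1, e2, e5, psi_eq_two_mul hθ]
  have e6 : a * Irel p θ = (1 - δ) / 2 := by rw [ha]; field_simp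
  have e7 : Cmain p θ * psi p 2 = (3 + θ) / 4 := by rw [Cmain]; field_simp
  set u := psi p 2 / (2 * Irel p θ) with hu
  have hu1 : u ≤ 1 := by
    rw [hu, div_le_one (by positivity)]
    linarith
  have hu0 : 0 ≤ u := by positivity
  have e8 : a * psi p 2 = (1 - δ) * u := by rw [ha, hu]; ring
  have e9 : b * psi p 2 = (3 + θ) / 4 - ε * psi p 2 - (1 - δ) * u := by
    rw [hb, sub_mul, sub_mul, e7, e8]
  have e10 : 2 + 2 * (a * -Irel p θ + b * -Irel p 2) + a * (θ * Irel p θ - 2 * psi p 2) +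
      b * (2 * Irel p 2 - psi p 2) =
      2 + (θ - 2) * (a * Irel p θ) - 2 * (a * psi p 2) - b * psi p 2 := by ring
  rw [e10, e6, e8, e9]
  nlinarith [mul_nonneg hδ0 hu0, mul_pos hε hψ]

lemma half_tilt_lt (hk : 2 ≤ k) (hpos : ∀ i, 0 < p i) (hsum : ∑ i, p i = 1) {θ ε δ : ℝ}
    (hε : 0 < ε) (hgap : Ctilde p + ε < Cmain p θ - ε) (hδ0 : 0 ≤ δ) :
    (1 - δ) / (2 * Irel p θ) < Cmain p θ - ε := by
  have hL := log_one_div_pmax_pos hk hpos hsum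
  have hIL := log_le_Irel hk hpos θ
  have h1 : (1 - δ) / (2 * Irel p θ) ≤ Ctilde p := by
    rw [Ctilde]
    exact div_le_div₀ zero_le_one (by linarith) hL (by linarith)
  linarith

end Exponents

section Asymptotics

open Filter Topology

lemma tendsto_log_natCast : Tendsto (fun N : ℕ => Real.log N) atTop atTop :=
  Real.tendsto_log_atTop.comp tendsto_natCast_atTop_atTop

lemma tendsto_floor_mul_log_div {c : ℝ} (hc : 0 ≤ c) :
    Tendsto (fun N : ℕ => (⌊c * Real.log N⌋₊ : ℝ) / Real.log N) atTop (𝓝 c) :=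
  (tendsto_nat_floor_mul_div_atTop hc).comp tendsto_log_natCast

lemma tendsto_atTop_of_div_log {u : ℕ → ℝ} {c : ℝ} (hc : 0 < c)
    (hu : Tendsto (fun N : ℕ => u N / Real.log N) atTop (𝓝 c)) : Tendsto u atTop atTop := by
  refine (hu.pos_mul_atTop hc tendsto_log_natCast).congr' ?_
  filter_upwards [tendsto_log_natCast.eventually_gt_atTop 0] with N hN
  exact div_mul_cancel₀ _ hN.ne'

lemma tendsto_div_of_abs_sub_le {u v : ℕ → ℝ} {r : ℝ} (hu : Tendsto u atTop atTop)
    (h : ∀ᶠ N in atTop, |v N - u N * r| ≤ 1) :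
    Tendsto (fun N => v N / u N) atTop (𝓝 r) := by
  rw [tendsto_iff_norm_sub_tendsto_zero]
  refine squeeze_zero' (Eventually.of_forall fun _ => norm_nonneg _) ?_ hu.inv_tendsto_atTop
  filter_upwards [h, hu.eventually_gt_atTop 0] with N hN h0
  have : v N / u N - r = (v N - u N * r) / u N := by field_simp
  rw [this, Real.norm_eq_abs, abs_div, abs_of_pos h0, Pi.inv_apply, ← one_div]
  gcongr

lemma tendsto_log_add_one_div {u : ℕ → ℝ} (hu : Tendsto u atTop atTop) :
    Tendsto (fun N => Real.log (u N + 1) / u N) atTop (𝓝 0) := by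
  have h1 : Tendsto (fun x : ℝ => Real.log x / x) atTop (𝓝 0) :=
    Real.isLittleO_log_id_atTop.tendsto_div_nhds_zero
  have h2 : Tendsto (fun N => u N + 1) atTop atTop := tendsto_atTop_add_const_right _ _ hu
  have h3 : Tendsto (fun N => (u N + 1) / u N) atTop (𝓝 1) := by
    have : Tendsto (fun N => 1 + (u N)⁻¹) atTop (𝓝 (1 + 0)) :=
      tendsto_const_nhds.add hu.inv_tendsto_atTop
    rw [add_zero] at this
    refine this.congr' ?_
    filter_upwards [hu.eventually_gt_atTop 0] with N hN
    field_simp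
  have h4 := (h1.comp h2).mul h3
  rw [zero_mul] at h4
  refine h4.congr' ?_
  filter_upwards [hu.eventually_gt_atTop 0] with N hN
  simp only [Function.comp]
  have : u N + 1 ≠ 0 := by linarith
  field_simp

/-- The logarithmic correction terms are negligible compared with `log N`. -/
lemma tendsto_correction_div_log (k : ℕ) {u : ℕ → ℝ} {c : ℝ} (hc : 0 < c)
    (hu : Tendsto (fun N : ℕ => u N / Real.log N) atTop (𝓝 c)) :
    Tendsto (fun N : ℕ => (2 * k * (Real.log (u N + 1) + 1) + 2 * Real.log (u N + 1) +
      Real.log 128) / Real.log N) atTop (𝓝 0) := by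
  have hu' := tendsto_atTop_of_div_log hc hu
  have h1 := (tendsto_log_add_one_div hu').mul hu
  have h2 : Tendsto (fun N : ℕ => (Real.log N)⁻¹) atTop (𝓝 0) :=
    tendsto_log_natCast.inv_tendsto_atTop
  have h3 := (h1.const_mul (2 * k + 2 : ℝ)).add (h2.const_mul (2 * k + Real.log 128 : ℝ))
  simp only [zero_mul, mul_zero, add_zero] at h3
  refine h3.congr' ?_
  filter_upwards [hu'.eventually_gt_atTop 0, tendsto_log_natCast.eventually_gt_atTop 0]
    with N h0 hN
  field_simp
  ring

lemma tendsto_Hent {k : ℕ} {u : ℕ → ℕ} {v : ℕ → Fin k → ℕ} {r : Fin k → ℝ}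
    (hv : ∀ᶠ N in atTop, ∑ i, v N i = u N)
    (h : ∀ i, Tendsto (fun N => (v N i : ℝ) / u N) atTop (𝓝 (r i))) :
    Tendsto (fun N => Hent (fun i => (v N i : ℝ))) atTop (𝓝 (∑ i, Real.negMulLog (r i))) := by
  have := tendsto_finsetSum univ fun i (_ : i ∈ univ) =>
    (Real.continuous_negMulLog.tendsto (r i)).comp (h i)
  refine this.congr' ?_
  filter_upwards [hv] with N hN
  have hN' : ∑ i, (v N i : ℝ) = u N := by exact_mod_cast hN
  simp only [Hent_eq_sum_negMulLog, hN', Function.comp]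

lemma tendsto_exponent {k : ℕ} (p : Fin k → ℝ) {a b : ℝ} {u u' : ℕ → ℕ} {v v' : ℕ → Fin k → ℕ}
    {r r' : Fin k → ℝ} (hv : ∀ᶠ N in atTop, ∑ i, v N i = u N)
    (hv' : ∀ᶠ N in atTop, ∑ i, v' N i = u' N)
    (ha : 0 < a) (hb : 0 < b)
    (hu : Tendsto (fun N : ℕ => (u N : ℝ) / Real.log N) atTop (𝓝 a))
    (hu' : Tendsto (fun N : ℕ => (u' N : ℝ) / Real.log N) atTop (𝓝 b))
    (h : ∀ i, Tendsto (fun N => (v N i : ℝ) / u N) atTop (𝓝 (r i)))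
    (h' : ∀ i, Tendsto (fun N => (v' N i : ℝ) / u' N) atTop (𝓝 (r' i))) :
    Tendsto (fun N : ℕ => 2 + (2 / Real.log N) *
        (∑ i, ((v N i + v' N i : ℕ) : ℝ) * Real.log (p i)) +
        ((u N : ℝ) / Real.log N) * Hent (fun i => (v N i : ℝ)) +
        ((u' N : ℝ) / Real.log N) * Hent (fun i => (v' N i : ℝ))) atTop
      (𝓝 (2 + 2 * (∑ i, (a * r i + b * r' i) * Real.log (p i)) +
        a * ∑ i, Real.negMulLog (r i) + b * ∑ i, Real.negMulLog (r' i))) := by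
  refine ((Tendsto.add tendsto_const_nhds ?_).add (hu.mul (tendsto_Hent hv h))).add
    (hu'.mul (tendsto_Hent hv' h'))
  have h1 := (tendsto_finsetSum univ fun i (_ : i ∈ univ) =>
    ((hu.mul (h i)).add (hu'.mul (h' i))).mul_const (Real.log (p i))).const_mul 2
  refine h1.congr' ?_
  filter_upwards [(tendsto_atTop_of_div_log ha hu).eventually_gt_atTop 0,
    (tendsto_atTop_of_div_log hb hu').eventually_gt_atTop 0,
    tendsto_log_natCast.eventually_gt_atTop 0] with N h0 h0' hN
  rw [div_mul_eq_mul_div, mul_div_assoc, sum_div]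
  congr 1
  refine sum_congr rfl fun i _ => ?_
  push_cast
  field_simp

end Asymptotics

/-- A word with `K` letters, `K ≥ C log N - 1` and `C > C̃_p`, has probability at most `1/N`. -/
lemma natCast_mul_prob_le_one {k : ℕ} (hk : 2 ≤ k) {p : Fin k → ℝ} (hpos : ∀ i, 0 < p i)
    (hsum : ∑ i, p i = 1) (v : Fin k → ℕ) {K N : ℕ} (hv : ∑ i, v i = K) (hN : 0 < N) {ε : ℝ}
    (hεN : 1 ≤ ε * Real.log N) (hK : (Ctilde p + ε) * Real.log N ≤ K + 1) :
    N * ∏ i, p i ^ v i ≤ 1 := by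
  have hL := log_one_div_pmax_pos hk hpos hsum
  have hN' : (0 : ℝ) < N := by exact_mod_cast hN
  have hq : 0 < ∏ i, p i ^ v i := prod_pos fun i _ => pow_pos (hpos i) _
  rw [← Real.log_nonpos_iff (by positivity), Real.log_mul hN'.ne' hq.ne',
    Real.log_prod fun i _ => (pow_pos (hpos i) _).ne']
  have h1 : ∑ i, Real.log (p i ^ v i) ≤ ∑ i, (v i : ℝ) * (-Real.log (1 / pmax p)) := by
    refine sum_le_sum fun i _ => ?_
    rw [Real.log_pow, one_div, Real.log_inv, neg_neg]
    exact mul_le_mul_of_nonneg_left (Real.log_le_log (hpos i) (le_pmax p i)) (by positivity)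
  have hv' : ∑ i, (v i : ℝ) = K := by exact_mod_cast hv
  rw [← sum_mul, hv'] at h1
  have h2 : Ctilde p * Real.log (1 / pmax p) = 1 := by
    rw [Ctilde, one_div, inv_mul_cancel₀ hL.ne']
  have h3 : Ctilde p * Real.log N ≤ K := by linarith
  have h4 := mul_le_mul_of_nonneg_right h3 hL.le
  have h5 : Ctilde p * Real.log N * Real.log (1 / pmax p) = Real.log N := by
    rw [mul_right_comm, h2, one_mul]
  linarith

/-- The quantitative lower bound on the number of expected repeats, on the logarithmic scale. -/
lemma rpow_exponent_le {k K A N : ℕ} {p : Fin k → ℝ} (hpos : ∀ i, 0 < p i)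
    {d0 d1 : Fin k} (hd : d0 ≠ d1) (hAK : A ≤ K) (Av Bv : Fin k → ℕ) (hA : ∑ i, Av i = A)
    (hB : ∑ i, Bv i = K - A) (h0 : 1 ≤ Bv d0) (h1 : 1 ≤ Bv d1) (hN : 2 ≤ N) {η : ℝ}
    (hη : 2 * k * (Real.log (K + 1) + 1) + 2 * Real.log (K + 1) + Real.log 128 ≤
      η * Real.log N) :
    (N : ℝ) ^ ((2 + (2 / Real.log N) * (∑ i, ((Av i + Bv i : ℕ) : ℝ) * Real.log (p i)) +
        ((A : ℝ) / Real.log N) * Hent (fun i => (Av i : ℝ)) +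
        (((K - A : ℕ) : ℝ) / Real.log N) * Hent (fun i => (Bv i : ℝ))) - η) ≤
      (univ.filter (fun s : Str k K => CLstr d0 d1 A Av Bv s)).card *
        (N * ∏ i, p i ^ (Av i + Bv i)) ^ 2 / 128 := by
  obtain ⟨hM, hE⟩ := entropy_le_log_card_CLstr hd hAK Av Bv hA hB h0 h1
  set M := (univ.filter (fun s : Str k K => CLstr d0 d1 A Av Bv s)).card
  have hM' : (0 : ℝ) < M := by exact_mod_cast hM
  have hN' : (0 : ℝ) < N := by positivity
  have hlog : 0 < Real.log N := Real.log_pos (by exact_mod_cast hN)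
  have hq : 0 < ∏ i, p i ^ (Av i + Bv i) := prod_pos fun i _ => pow_pos (hpos i) _
  rw [← Real.log_le_log_iff (by positivity) (by positivity), Real.log_rpow hN',
    Real.log_div (by positivity) (by positivity), Real.log_mul hM'.ne' (by positivity),
    Real.log_pow, Real.log_mul hN'.ne' hq.ne',
    Real.log_prod fun i _ => (pow_pos (hpos i) _).ne']
  simp only [Real.log_pow]
  set S := ∑ i, ((Av i + Bv i : ℕ) : ℝ) * Real.log (p i)
  have hexp : ((2 + (2 / Real.log N) * S +
        ((A : ℝ) / Real.log N) * Hent (fun i => (Av i : ℝ)) +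
        (((K - A : ℕ) : ℝ) / Real.log N) * Hent (fun i => (Bv i : ℝ))) - η) * Real.log N =
      2 * Real.log N + 2 * S + A * Hent (fun i => (Av i : ℝ)) +
        ((K - A : ℕ) : ℝ) * Hent (fun i => (Bv i : ℝ)) - η * Real.log N := by
    field_simp
  rw [hexp]
  push_cast
  linarith

/-- **Lemma (many collision-likely repeats)**: in the regime `C̃_p + ε < C_p - ε`, with
`K = ⌊(C_p - ε) log N⌋`, `A = ⌊(1-δ) log N / (2 I(p,p^θ))⌋`, integer digit counts `Av, Bv`
approximating `A p_i^θ/φ_p(θ)` and `B p_i²/φ_p(2)` (where `B = K - A`), and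
`γ = 2 + (2/log N) ∑ (A_i+B_i) log p_i + (A/log N) H(Av) + (B/log N) H(Bv)`, the probability
that at least `N^{γ-δ}` distinct collision-likely strings appear two or more times among the
`N` strings of a `p`-random sequence tends to `1` as `N → ∞`. -/
theorem many_collision_likely_repeats (k : ℕ) (hk : 2 ≤ k) (p : Fin k → ℝ)
    (hpos : ∀ i, 0 < p i) (hsum : ∑ i, p i = 1)
    (θ : ℝ) (hθ : phi p θ = (phi p 2) ^ 2) (ε : ℝ) (hε : 0 < ε)
    (hgap : Ctilde p + ε < Cmain p θ - ε) :
    ∃ δ₀ : ℝ, 0 < δ₀ ∧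
      ∀ δ : ℝ, 0 < δ → δ ≤ δ₀ →
      ∀ (KN AN : ℕ → ℕ) (Av Bv : ℕ → Fin k → ℕ),
        (∀ N : ℕ, KN N = ⌊(Cmain p θ - ε) * Real.log N⌋₊) →
        (∀ N : ℕ, AN N = ⌊(1 - δ) * Real.log N / (2 * Irel p θ)⌋₊) →
        (∀ N : ℕ, ∑ i, Av N i = AN N) →
        (∀ (N : ℕ) (i : Fin k), |(Av N i : ℝ) - (AN N : ℝ) * p i ^ θ / phi p θ| ≤ 1) →
        (∀ N : ℕ, ∑ i, Bv N i = KN N - AN N) →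
        (∀ (N : ℕ) (i : Fin k),
          |(Bv N i : ℝ) - ((KN N - AN N : ℕ) : ℝ) * p i ^ 2 / phi p 2| ≤ 1) →
        Filter.Tendsto (fun N : ℕ =>
            ∑ ω ∈ univ.filter (fun ω : Fin N → Str k (KN N) =>
                (N : ℝ) ^
                    ((2 + (2 / Real.log N) *
                        (∑ i, ((Av N i + Bv N i : ℕ) : ℝ) * Real.log (p i)) +
                      ((AN N : ℝ) / Real.log N) * Hent (fun i => (Av N i : ℝ)) +
                      (((KN N - AN N : ℕ) : ℝ) / Real.log N) * Hent (fun i => (Bv N i : ℝ)))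
                      - δ) ≤
                  ((univ.filter (fun s : Str k (KN N) =>
                      CLstr ⟨0, by omega⟩ ⟨1, by omega⟩ (AN N) (Av N) (Bv N) s ∧
                        2 ≤ (univ.filter (fun j : Fin N => ω j = s)).card)).card : ℝ)),
              seqP p ω)
          Filter.atTop (nhds 1) := by
  have hψ := psi_two_pos hk hpos hsum
  have hL := log_one_div_pmax_pos hk hpos hsum
  have hI : 0 < Irel p θ := hL.trans_le (log_le_Irel hk hpos θ)
  have hθ3 := three_le_of_phi_eq hk hpos hsum hθ
  refine ⟨min (1 / 2) (ε * psi p 2 / (θ - 2)),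
    lt_min (by norm_num) (div_pos (mul_pos hε hψ) (by linarith)), ?_⟩
  intro δ hδ hδ₀ KN AN Av Bv hKN hAN hAsum hAv hBsum hBv
  have hδ1 : δ ≤ 1 / 2 := hδ₀.trans (min_le_left _ _)
  have hδ2 : δ * (θ - 2) ≤ ε * psi p 2 := by
    rw [← le_div_iff₀ (by linarith)]
    exact hδ₀.trans (min_le_right _ _)
  set a := (1 - δ) / (2 * Irel p θ) with ha
  set c := Cmain p θ - ε with hc
  have ha0 : 0 < a := div_pos (by linarith) (by linarith)
  have hac : a < c := half_tilt_lt hk hpos hsum hε hgap hδ.le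
  have hb0 : 0 < c - a := by linarith
  have hK : Filter.Tendsto (fun N : ℕ => (KN N : ℝ) / Real.log N) Filter.atTop (nhds c) := by
    simp only [hKN]
    exact tendsto_floor_mul_log_div (by linarith)
  have hA : Filter.Tendsto (fun N : ℕ => (AN N : ℝ) / Real.log N) Filter.atTop (nhds a) := by
    have h : ∀ N : ℕ, (1 - δ) * Real.log N / (2 * Irel p θ) = a * Real.log N := fun N => by
      rw [ha]; ring
    simp only [hAN, h]
    exact tendsto_floor_mul_log_div ha0.le
  have hAK : ∀ N, AN N ≤ KN N := by
    intro N
    rw [hAN, hKN]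
    refine Nat.floor_le_floor ?_
    rw [mul_div_right_comm]
    exact mul_le_mul_of_nonneg_right hac.le (Real.log_natCast_nonneg N)
  have hB : Filter.Tendsto (fun N : ℕ => ((KN N - AN N : ℕ) : ℝ) / Real.log N) Filter.atTop
      (nhds (c - a)) := by
    refine (hK.sub hA).congr fun N => ?_
    rw [Nat.cast_sub (hAK N), sub_div]
  have hAfreq : ∀ i, Filter.Tendsto (fun N => (Av N i : ℝ) / AN N) Filter.atTop
      (nhds (p i ^ θ / phi p θ)) := fun i =>
    tendsto_div_of_abs_sub_le (tendsto_atTop_of_div_log ha0 hA) <| Filter.Eventually.of_forall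
      fun N => by rw [← mul_div_assoc]; exact hAv N i
  have hBfreq : ∀ i, Filter.Tendsto (fun N => (Bv N i : ℝ) / ((KN N - AN N : ℕ) : ℝ))
      Filter.atTop (nhds (p i ^ 2 / phi p 2)) := fun i =>
    tendsto_div_of_abs_sub_le (tendsto_atTop_of_div_log hb0 hB) <| Filter.Eventually.of_forall
      fun N => by rw [← mul_div_assoc]; exact hBv N i
  have hBpos : ∀ i, ∀ᶠ N in Filter.atTop, 1 ≤ Bv N i := by
    intro i
    have hr : 0 < p i ^ 2 / phi p 2 := div_pos (pow_pos (hpos i) 2) (phi_pos hk hpos 2)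
    filter_upwards [(hBfreq i).eventually (lt_mem_nhds hr)] with N hN
    by_contra h
    have h0 : Bv N i = 0 := by omega
    simp [h0] at hN
  have hlim := tendsto_exponent p (Filter.Eventually.of_forall hAsum)
    (Filter.Eventually.of_forall hBsum) ha0 hb0 hA hB hAfreq hBfreq
  have hγ := limit_exponent_pos hk hpos hsum hθ hε hδ.le hδ2
  rw [← ha, ← hc] at hγ
  set γ := 2 + 2 * (∑ i, (a * (p i ^ θ / phi p θ) + (c - a) * (p i ^ 2 / phi p 2)) *
    Real.log (p i)) + a * ∑ i, Real.negMulLog (p i ^ θ / phi p θ) +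
    (c - a) * ∑ i, Real.negMulLog (p i ^ 2 / phi p 2)
  set η := min δ (γ / 4) with hη
  have hη0 : 0 < η := lt_min hδ (by linarith)
  have hcorr := tendsto_correction_div_log k (ha0.trans hac) hK
  have hbound : Filter.Tendsto (fun N : ℕ => 1 - 4 / (N : ℝ) ^ (γ / 4)) Filter.atTop
      (nhds 1) := by
    have h1 : Filter.Tendsto (fun N : ℕ => (N : ℝ) ^ (γ / 4)) Filter.atTop Filter.atTop :=
      (tendsto_rpow_atTop (by linarith)).comp tendsto_natCast_atTop_atTop
    simpa using (h1.const_div_atTop 4).const_sub 1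
  have hw : ∀ (K : ℕ) (s : Str k K), 0 ≤ strP p s :=
    fun K s => prod_nonneg fun j _ => (hpos _).le
  refine tendsto_of_tendsto_of_tendsto_of_le_of_le' hbound tendsto_const_nhds ?_
    (Filter.Eventually.of_forall fun N => prob_le_one (strP p) (hw _) (sum_strP p hsum _) N _)
  filter_upwards [Filter.eventually_ge_atTop 2, hBpos ⟨0, by omega⟩, hBpos ⟨1, by omega⟩,
    hlim.eventually (lt_mem_nhds (half_lt_self hγ)), hcorr.eventually (gt_mem_nhds hη0),
    tendsto_log_natCast.eventually_ge_atTop (1 / ε)] with N hN h0 h1 hexp hcor hlogN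
  have hN1 : (1 : ℝ) ≤ N := by exact_mod_cast (by omega : 1 ≤ N)
  have hlogpos : 0 < Real.log N := (one_div_pos.2 hε).trans_le hlogN
  have hd : (⟨0, by omega⟩ : Fin k) ≠ ⟨1, by omega⟩ := by simp
  have hx := rpow_exponent_le hpos hd (hAK N) (Av N) (Bv N) (hAsum N) (hBsum N) h0 h1 hN
    ((div_le_iff₀ hlogpos).1 hcor.le)
  have hNq := natCast_mul_prob_le_one hk hpos hsum (fun i => Av N i + Bv N i) (K := KN N)
    (N := N) (ε := ε)
    (by rw [sum_add_distrib, hAsum, hBsum, Nat.add_sub_cancel' (hAK N)]) (by omega)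
    (by rw [div_le_iff₀ hε] at hlogN; linarith)
    (by
      have h2 := Nat.lt_floor_add_one (c * Real.log N)
      rw [← hKN] at h2
      exact (mul_le_mul_of_nonneg_right hgap.le hlogpos.le).trans h2.le)
  have hprob := one_sub_le_prob_many_repeats (strP p) (hw (KN N)) (sum_strP p hsum (KN N))
    (univ.filter (fun s : Str k (KN N) => CLstr ⟨0, by omega⟩ ⟨1, by omega⟩ (AN N) (Av N)
      (Bv N) s)) _ (fun s hs => strP_eq_of_CLstr p (mem_filter.1 hs).2)
    (prod_nonneg fun i _ => pow_nonneg (hpos i).le _) N hN hNq _ _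
    (Real.rpow_pos_of_pos (by linarith) _) hx
    (Real.rpow_le_rpow_of_exponent_le hN1 (sub_le_sub_left (min_le_left δ (γ / 4)) _))
  simp only [filter_filter] at hprob
  refine le_trans ?_ hprob
  refine sub_le_sub_left (div_le_div_of_nonneg_left (by norm_num)
    (Real.rpow_pos_of_pos (by linarith) _) (Real.rpow_le_rpow_of_exponent_le hN1 ?_)) _
  have : η ≤ γ / 4 := min_le_right _ _
  linarith

end RiffleShuffle
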